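/- arXiv:2407.03975 — 2 statements merged into one kernel-verified Lean document; each statement's English description precedes it below -/
import Mathlib

section
/- Let Ω ⊆ ℝ² be open, bounded and simply connected (as a topological subspace of ℝ²). Let y₁, y₂ ∈ ∂Ω with y₁ ≠ y₂ and with equal second coordinates, and suppose that the open segment S := {(1−t)y₁ + t·y₂ : t ∈ (0,1)} is contained in Ω. Then Ω ∖ S is not connected. -/
/-- The plane `ℝ²` with the Euclidean norm. -/
abbrev Plane : Type := EuclideanSpace ℝ (Fin 2)

open Complex Filter Topology Set

theorem stmt17_slit (z y₁ y₂ : Plane) (h1 : z ≠ y₁)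
    (hS : z ∉ openSegment ℝ y₁ y₂)
    (f : Plane → ℂ) (hf : f = fun z => ((z 0 : ℂ) + (z 1 : ℂ) * I))
    (hinj : Function.Injective f) (h2 : z ≠ y₂) :
    (f z - f y₁) / (f z - f y₂) ∈ slitPlane := by
  by_contra hc
  have hz2 : f z - f y₂ ≠ 0 := sub_ne_zero.2 (fun h => h2 (hinj h))
  rw [mem_slitPlane_iff] at hc
  push Not at hc
  obtain ⟨hre, him⟩ := hc
  set w := (f z - f y₁) / (f z - f y₂) with hw
  have hwr : w = (w.re : ℂ) := by apply Complex.ext <;> simp [him]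
  have hw0 : w ≠ 0 := div_ne_zero (sub_ne_zero.2 (fun h => h1 (hinj h))) hz2
  have hlt : w.re < 0 := lt_of_le_of_ne hre (fun h => hw0 (by rw [hwr, h]; simp))
  have heq : f z - f y₁ = (w.re : ℂ) * (f z - f y₂) := by
    rw [← hwr, hw]; field_simp
  generalize w.re = r at *
  have e0 := congrArg Complex.re heq
  have e1 := congrArg Complex.im heq
  simp [hf] at e0 e1
  apply hS
  have hp : (0:ℝ) < 1 - r := by linarith
  refine ⟨1 / (1 - r), -r / (1 - r), by positivity, div_pos (by linarith) hp, by field_simp; ring, ?_⟩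
  ext i
  fin_cases i
  · simp; field_simp; linarith
  · simp; field_simp; linarith

theorem stmt17 (Ω : Set Plane) (hΩo : IsOpen Ω) (hΩb : Bornology.IsBounded Ω)
    (hΩsc : SimplyConnectedSpace ↥Ω)
    (y₁ y₂ : Plane) (hy₁ : y₁ ∈ frontier Ω) (hy₂ : y₂ ∈ frontier Ω) (hne : y₁ ≠ y₂)
    (hhor : y₁ 1 = y₂ 1)
    (hseg : openSegment ℝ y₁ y₂ ⊆ Ω) :
    ¬ IsPreconnected (Ω \ openSegment ℝ y₁ y₂) := by
  intro hpre
  rw [hΩo.frontier_eq] at hy₁ hy₂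
  have hn1 : ∀ z ∈ Ω, z ≠ y₁ := fun z hz h => hy₁.2 (h ▸ hz)
  have hn2 : ∀ z ∈ Ω, z ≠ y₂ := fun z hz h => hy₂.2 (h ▸ hz)
  obtain ⟨f, hf⟩ : ∃ f : Plane → ℂ, f = fun z => ((z 0 : ℂ) + (z 1 : ℂ) * I) := ⟨_, rfl⟩
  have hfc : Continuous f := by rw [hf]; fun_prop
  have hinj : Function.Injective f := by
    intro a b hab
    have e0 := congrArg Complex.re hab
    have e1 := congrArg Complex.im hab
    simp [hf] at e0 e1
    ext i
    fin_cases i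
    · exact e0
    · exact e1
  obtain ⟨g, hg⟩ : ∃ g : Plane → ℂ, g = fun z => (f z - f y₁) / (f z - f y₂) := ⟨_, rfl⟩
  have hgc : ContinuousOn g Ω := by
    rw [hg]
    exact (by fun_prop : ContinuousOn (fun z => f z - f y₁) Ω).div (by fun_prop)
      (fun z hz => sub_ne_zero.2 (fun h => hn2 z hz (hinj h)))
  have hg0 : ∀ z ∈ Ω, g z ≠ 0 := by
    intro z hz
    rw [hg]
    exact div_ne_zero (sub_ne_zero.2 (fun h => hn1 z hz (hinj h)))
      (sub_ne_zero.2 (fun h => hn2 z hz (hinj h)))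
  have hgs : ∀ z ∈ Ω \ openSegment ℝ y₁ y₂, g z ∈ slitPlane := by
    intro z hz
    rw [hg]
    exact stmt17_slit z y₁ y₂ (hn1 z hz.1) hz.2 f hf hinj (hn2 z hz.1)
  obtain ⟨L, hLc, hL⟩ := exists_continuousOn_eqOn_exp_comp
    (hΩsc : IsSimplyConnected Ω) hΩo hgc
    (by rintro ⟨z, hz, h⟩; exact hg0 z hz h)
  have hk : ∃ k, ∀ z ∈ Ω \ openSegment ℝ y₁ y₂, L z - log (g z) = k := by
    rcases (Ω \ openSegment ℝ y₁ y₂).eq_empty_or_nonempty with h | ⟨p, hp⟩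
    · exact ⟨0, by simp [h]⟩
    · refine ⟨L p - log (g p), fun z hz => ?_⟩
      refine Complex.isCoveringMap_exp.constOn_of_comp
        (g := fun z => L z - log (g z)) hpre ?_ ?_ hz hp
      · exact (hLc.mono diff_subset).sub ((hgc.mono diff_subset).clog hgs)
      · have : ∀ a ∈ Ω \ openSegment ℝ y₁ y₂, exp (L a - log (g a)) = 1 := by
          intro a ha
          have := hL ha.1
          simp only [Function.comp] at this
          rw [exp_sub, this, exp_log (hg0 a ha.1), div_self (hg0 a ha.1)]
        intro a ha b hb
        apply Subtype.ext
        simp only [this a ha, this b hb]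
  obtain ⟨k, hk⟩ := hk
  obtain ⟨d, hd⟩ : ∃ d : ℝ, d = (y₂ 0 - y₁ 0) / 2 := ⟨_, rfl⟩
  have hd0 : d ≠ 0 := by
    intro h
    apply hne
    ext i
    fin_cases i
    · simp; linarith
    · exact hhor
  obtain ⟨γ, hγ⟩ : ∃ γ : ℝ → Plane, γ = fun t => !₂[y₁ 0 + d, y₁ 1 + t * d] := ⟨_, rfl⟩
  have hγc : Continuous γ := by rw [hγ]; fun_prop
  have hγ0 : γ 0 ∈ openSegment ℝ y₁ y₂ := by
    refine ⟨1/2, 1/2, by norm_num, by norm_num, by norm_num, ?_⟩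
    ext i
    fin_cases i
    · simp [hγ]; linarith
    · simp [hγ]; linarith
  have hγΩ : ∀ᶠ t in 𝓝 (0:ℝ), γ t ∈ Ω :=
    hγc.continuousAt.eventually_mem (hΩo.mem_nhds (hseg hγ0))
  have hγS : ∀ t, t ≠ 0 → γ t ∉ openSegment ℝ y₁ y₂ := by
    rintro t ht ⟨a, b, ha, hb, hab, h⟩
    have e1 := congrArg (fun v : Plane => v 1) h
    simp [hγ, ← hhor] at e1
    rw [← add_mul, hab] at e1
    have : t * d = 0 := by linarith
    exact mul_ne_zero ht hd0 this
  have hgγ : ∀ t : ℝ, g (γ t) = ((-(1 - t^2) / (1 + t^2) : ℝ) : ℂ) + ((-2 * t / (1 + t^2) : ℝ) : ℂ) * I := by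
    intro t
    have hdC : (d : ℂ) ≠ 0 := by exact_mod_cast hd0
    have e1 : f (γ t) - f y₁ = d * (1 + t * I) := by
      simp [hf, hγ]; ring
    have e2 : f (γ t) - f y₂ = d * (-1 + t * I) := by
      have : y₂ 0 = y₁ 0 + 2 * d := by linarith
      simp [hf, hγ, ← hhor, this]; ring
    have hq : (1 + (t:ℂ)^2) ≠ 0 := by
      have : (1 + t^2 : ℝ) ≠ 0 := by positivity
      exact_mod_cast this
    have hm : (-1 + (t:ℂ) * I) ≠ 0 := by
      intro h
      have := congrArg Complex.re h
      simp at this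
    rw [hg]
    simp only [e1, e2]
    rw [mul_div_mul_left _ _ hdC]
    push_cast
    rw [div_eq_iff hm]
    field_simp
    linear_combination (2 * (t:ℂ)^2) * I_sq
  have hg00 : g (γ 0) = -1 := by rw [hgγ]; simp
  have hgt : Tendsto (fun t => g (γ t)) (𝓝 0) (𝓝 (-1)) := by
    rw [← hg00]
    exact ((hgc.continuousAt (hΩo.mem_nhds (hseg hγ0))).tendsto.comp hγc.continuousAt)
  have hLt : Tendsto (fun t => L (γ t) - k) (𝓝 0) (𝓝 (L (γ 0) - k)) :=
    ((hLc.continuousAt (hΩo.mem_nhds (hseg hγ0))).tendsto.comp hγc.continuousAt).sub_const k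
  have hev : ∀ᶠ t in 𝓝 (0:ℝ), t ≠ 0 → L (γ t) - k = log (g (γ t)) := by
    filter_upwards [hγΩ] with t ht h0
    rw [← hk (γ t) ⟨ht, hγS t h0⟩]; ring
  have hA : Tendsto (fun t => log (g (γ t))) (𝓝[>] 0) (𝓝 (Real.log ‖(-1:ℂ)‖ - Real.pi * I)) := by
    refine (tendsto_log_nhdsWithin_im_neg_of_re_neg_of_im_zero (z := -1) (by simp) (by simp)).comp
      (tendsto_nhdsWithin_iff.2 ⟨hgt.mono_left nhdsWithin_le_nhds, ?_⟩)
    filter_upwards [self_mem_nhdsWithin] with t ht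
    have ht : 0 < t := ht
    simp only [mem_setOf_eq, hgγ, add_im, ofReal_im, re_ofReal_mul, im_ofReal_mul, I_im]
    have : -2 * t / (1 + t^2) < 0 := div_neg_of_neg_of_pos (by linarith) (by positivity)
    linarith
  have hB : Tendsto (fun t => log (g (γ t))) (𝓝[<] 0) (𝓝 (Real.log ‖(-1:ℂ)‖ + Real.pi * I)) := by
    refine (tendsto_log_nhdsWithin_im_nonneg_of_re_neg_of_im_zero (z := -1) (by simp) (by simp)).comp
      (tendsto_nhdsWithin_iff.2 ⟨hgt.mono_left nhdsWithin_le_nhds, ?_⟩)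
    filter_upwards [self_mem_nhdsWithin] with t ht
    have ht : t < 0 := ht
    simp only [mem_setOf_eq, hgγ, add_im, ofReal_im, re_ofReal_mul, im_ofReal_mul, I_im]
    have : 0 < -2 * t / (1 + t^2) := div_pos (by linarith) (by positivity)
    linarith
  have hA' := tendsto_nhds_unique (hA.congr' (by
    filter_upwards [self_mem_nhdsWithin, nhdsWithin_le_nhds hev] with t ht h
    exact (h (ne_of_gt ht)).symm)) (hLt.mono_left nhdsWithin_le_nhds)
  have hB' := tendsto_nhds_unique (hB.congr' (by
    filter_upwards [self_mem_nhdsWithin, nhdsWithin_le_nhds hev] with t ht h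
    exact (h (ne_of_lt ht)).symm)) (hLt.mono_left nhdsWithin_le_nhds)
  have h := congrArg Complex.im (hA'.trans hB'.symm)
  simp at h
  linarith [Real.pi_pos]
end

section
/- Let Ω ⊆ ℝ² be open, bounded and simply connected (as a topological subspace of ℝ²). Let y₁, y₂ ∈ ∂Ω with y₁ ≠ y₂ and with equal second coordinates, and suppose that the open segment S := {(1−t)y₁ + t·y₂ : t ∈ (0,1)} is contained in Ω. Then Ω ∖ S has exactly two connected components: there exist disjoint nonempty open connected sets Ω₊ and Ω₋ with Ω ∖ S = Ω₊ ∪ Ω₋. -/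
open Set Filter Topology

/-- The open segment in coordinates. -/
lemma mem_seg_iff (y₁ y₂ : Plane) (hne : y₁ ≠ y₂) (hhor : y₁ 1 = y₂ 1) (x : Plane) :
    x ∈ openSegment ℝ y₁ y₂ ↔ x 1 = y₁ 1 ∧ (x 0 - y₁ 0) * (x 0 - y₂ 0) < 0 := by
  have h0 : y₁ 0 ≠ y₂ 0 := by
    intro h
    apply hne
    ext i
    fin_cases i
    · exact h
    · exact hhor
  have h0' : y₂ 0 - y₁ 0 ≠ 0 := sub_ne_zero.2 h0.symm
  have hsq : 0 < (y₂ 0 - y₁ 0) ^ 2 := by positivity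
  rw [openSegment_eq_image]
  constructor
  · rintro ⟨t, ⟨ht0, ht1⟩, rfl⟩
    simp only [PiLp.add_apply, PiLp.smul_apply, smul_eq_mul]
    refine ⟨by rw [← hhor]; ring, ?_⟩
    have : ((1 - t) * y₁ 0 + t * y₂ 0 - y₁ 0) * ((1 - t) * y₁ 0 + t * y₂ 0 - y₂ 0)
        = - (t * (1 - t) * (y₂ 0 - y₁ 0) ^ 2) := by ring
    rw [this]
    have : 0 < t * (1 - t) * (y₂ 0 - y₁ 0) ^ 2 :=
      mul_pos (mul_pos ht0 (by linarith)) hsq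
    linarith
  · rintro ⟨h1, h2⟩
    have e1 : (x 0 - y₁ 0) / (y₂ 0 - y₁ 0) * (y₂ 0 - y₁ 0) = x 0 - y₁ 0 := by
      field_simp
    set t := (x 0 - y₁ 0) / (y₂ 0 - y₁ 0) with ht
    have hx : x 0 = y₁ 0 + t * (y₂ 0 - y₁ 0) := by linarith
    have h3 : 0 < t * (1 - t) := by
      by_contra hcon
      have : (x 0 - y₁ 0) * (x 0 - y₂ 0) = - (t * (1 - t) * (y₂ 0 - y₁ 0) ^ 2) := by
        rw [hx]; ring
      nlinarith
    refine ⟨t, ⟨by nlinarith, by nlinarith⟩, ?_⟩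
    ext i
    fin_cases i
    · simp only [PiLp.add_apply, PiLp.smul_apply, smul_eq_mul, Fin.zero_eta]
      rw [hx]; ring
    · simp only [PiLp.add_apply, PiLp.smul_apply, smul_eq_mul, Fin.mk_one]
      rw [h1, ← hhor]; ring

lemma exists_side_pt (c : ℝ) (σ : ℝ) (hσ : σ ≠ 0) (s : Plane) (hs : s 1 = c) (U : Set Plane)
    (hU : U ∈ 𝓝 s) : ∃ p ∈ U, 0 < σ * (p 1 - c) := by
  have hc : Continuous (fun t : ℝ => s + (t * σ) • (EuclideanSpace.single 1 1 : Plane)) := by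
    fun_prop
  have h0 : Tendsto (fun t : ℝ => s + (t * σ) • (EuclideanSpace.single 1 1 : Plane)) (𝓝[>] 0)
      (𝓝 s) := by
    have := (hc.tendsto 0).mono_left (nhdsWithin_le_nhds (s := Ioi 0))
    simpa using this
  obtain ⟨t, htU, ht⟩ := ((h0.eventually hU).and self_mem_nhdsWithin).exists
  refine ⟨_, htU, ?_⟩
  have ht' : (0 : ℝ) < t := ht
  have : σ * ((s + (t * σ) • (EuclideanSpace.single 1 1 : Plane)) 1 - c) = t * σ ^ 2 := by
    simp [hs]; ring
  rw [this]
  positivity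

/-- One side of the segment lies in one component of the complement. -/
lemma side (Ω S : Set Plane) (hΩo : IsOpen Ω) (hWo : IsOpen (Ω \ S)) (c : ℝ)
    (hS : ∀ s ∈ S, s 1 = c) (hSc : Convex ℝ S) (hSΩ : S ⊆ Ω) (hSn : S.Nonempty)
    (σ : ℝ) (hσ : σ ≠ 0) :
    ∃ P : Set Plane, IsOpen P ∧ IsConnected P ∧ P ⊆ Ω \ S ∧
      (∀ C : Set Plane, IsPreconnected C → C ⊆ Ω \ S → (C ∩ P).Nonempty → C ⊆ P) ∧
      ∀ s ∈ S, ∀ᶠ x in 𝓝 s, 0 < σ * (x 1 - c) → x ∈ P := by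
  obtain ⟨s₀, hs₀⟩ := hSn
  have hup : Convex ℝ {x : Plane | 0 < σ * (x 1 - c)} := by
    intro x hx y hy a b ha hb hab
    simp only [mem_ofPred_eq, PiLp.add_apply, PiLp.smul_apply, smul_eq_mul] at *
    have : σ * (a * x 1 + b * y 1 - c) = a * (σ * (x 1 - c)) + b * (σ * (y 1 - c)) := by
      have : c = (a + b) * c := by rw [hab]; ring
      linear_combination (-σ) * this
    rw [this]
    rcases ha.eq_or_lt with h | h
    · have : b = 1 := by linarith
      subst this; rw [← h]; simpa using hy
    · exact add_pos_of_pos_of_nonneg (mul_pos h hx) (mul_nonneg hb hy.le)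
  have hupS : ∀ x ∈ Ω, 0 < σ * (x 1 - c) → x ∈ Ω \ S := by
    intro x hx h
    refine ⟨hx, fun hxS => ?_⟩
    rw [hS x hxS] at h
    simp at h
  obtain ⟨r, hr, hrΩ⟩ := Metric.isOpen_iff.1 hΩo s₀ (hSΩ hs₀)
  obtain ⟨p₀, hp₀, hp₀'⟩ := exists_side_pt c σ hσ s₀ (hS s₀ hs₀) _ (Metric.ball_mem_nhds s₀ hr)
  have hp₀W := hupS p₀ (hrΩ hp₀) hp₀'
  have hmax : ∀ C : Set Plane, IsPreconnected C → C ⊆ Ω \ S →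
      (C ∩ connectedComponentIn (Ω \ S) p₀).Nonempty → C ⊆ connectedComponentIn (Ω \ S) p₀ := by
    rintro C hC hCW ⟨q, hqC, hqP⟩
    rw [connectedComponentIn_eq hqP]
    exact hC.subset_connectedComponentIn hqC hCW
  have hpmem := mem_connectedComponentIn hp₀W
  refine ⟨connectedComponentIn (Ω \ S) p₀, hWo.connectedComponentIn,
    isConnected_connectedComponentIn_iff.2 hp₀W, connectedComponentIn_subset _ _, hmax, ?_⟩
  intro s hs
  have hseg : segment ℝ s₀ s ⊆ Ω := (hSc.segment_subset hs₀ hs).trans hSΩ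
  have hcomp : IsCompact (segment ℝ s₀ s) := by
    rw [segment_eq_image]
    exact isCompact_Icc.image (by fun_prop)
  obtain ⟨δ, hδ, hδΩ⟩ := hcomp.exists_thickening_subset_open hΩo hseg
  have hball : ∀ x ∈ segment ℝ s₀ s, Metric.ball x δ ⊆ Metric.thickening δ (segment ℝ s₀ s) :=
    fun x hx => Metric.ball_subset_thickening hx δ
  obtain ⟨q, ⟨hq1, hq2⟩, hq'⟩ := exists_side_pt c σ hσ s₀ (hS s₀ hs₀) _
    (inter_mem (Metric.ball_mem_nhds s₀ hr) (Metric.ball_mem_nhds s₀ hδ))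
  have hqP : q ∈ connectedComponentIn (Ω \ S) p₀ :=
    hmax (Metric.ball s₀ r ∩ {x : Plane | 0 < σ * (x 1 - c)})
      ((convex_ball _ _).inter hup).isPreconnected
      (fun x hx => hupS x (hrΩ hx.1) hx.2) ⟨p₀, ⟨hp₀, hp₀'⟩, hpmem⟩ ⟨hq1, hq'⟩
  filter_upwards [Metric.ball_mem_nhds s hδ] with x hx hx'
  exact hmax (Metric.thickening δ (segment ℝ s₀ s) ∩ {x : Plane | 0 < σ * (x 1 - c)})
      (((convex_segment _ _).thickening δ).inter hup).isPreconnected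
      (fun x hx => hupS x (hδΩ hx.1) hx.2)
      ⟨q, ⟨hball _ (left_mem_segment ℝ _ _) hq2, hq'⟩, hqP⟩
      ⟨hball _ (right_mem_segment ℝ _ _) hx, hx'⟩

theorem stmt18 (Ω : Set Plane) (hΩo : IsOpen Ω) (hΩb : Bornology.IsBounded Ω)
    (hΩsc : SimplyConnectedSpace ↥Ω)
    (y₁ y₂ : Plane) (hy₁ : y₁ ∈ frontier Ω) (hy₂ : y₂ ∈ frontier Ω) (hne : y₁ ≠ y₂)
    (hhor : y₁ 1 = y₂ 1)
    (hseg : openSegment ℝ y₁ y₂ ⊆ Ω) :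
    ∃ Ωp Ωm : Set Plane, IsOpen Ωp ∧ IsOpen Ωm ∧ IsConnected Ωp ∧ IsConnected Ωm ∧
      Disjoint Ωp Ωm ∧ Ω \ openSegment ℝ y₁ y₂ = Ωp ∪ Ωm := by
  have hmem := mem_seg_iff y₁ y₂ hne hhor
  have hSc : Convex ℝ (openSegment ℝ y₁ y₂) := convex_openSegment y₁ y₂
  have hSn : (openSegment ℝ y₁ y₂).Nonempty :=
    ⟨_, midpoint_mem_openSegment y₁ y₂⟩
  have hn₁ : y₁ ∉ Ω := by rw [hΩo.frontier_eq] at hy₁; exact hy₁.2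
  have hn₂ : y₂ ∉ Ω := by rw [hΩo.frontier_eq] at hy₂; exact hy₂.2
  have hext : ∀ x y : Plane, x 0 = y 0 → x 1 = y 1 → x = y := by
    intro x y h0 h1
    ext i
    fin_cases i
    · exact h0
    · exact h1
  have h0 : y₁ 0 - y₂ 0 ≠ 0 := fun h => hne (hext _ _ (by linarith) hhor)
  generalize openSegment ℝ y₁ y₂ = S at *
  have hmem' : ∀ x ∈ Ω, x 1 = y₁ 1 → (x 0 - y₁ 0) * (x 0 - y₂ 0) ≤ 0 → x ∈ S := by
    intro x hx h1 h2
    rw [hmem]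
    refine ⟨h1, lt_of_le_of_ne h2 fun h => ?_⟩
    rcases mul_eq_zero.1 h with h | h
    · exact hn₁ (hext x y₁ (by linarith) h1 ▸ hx)
    · exact hn₂ (hext x y₂ (by linarith) (h1.trans hhor) ▸ hx)
  have hWo : IsOpen (Ω \ S) := by
    have : Ω \ S = Ω \ {x : Plane | x 1 = y₁ 1 ∧ (x 0 - y₁ 0) * (x 0 - y₂ 0) ≤ 0} := by
      ext x
      constructor
      · rintro ⟨hx, hxS⟩
        exact ⟨hx, fun h => hxS (hmem' x hx h.1 h.2)⟩
      · rintro ⟨hx, hxS⟩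
        exact ⟨hx, fun h => hxS ⟨((hmem x).1 h).1, ((hmem x).1 h).2.le⟩⟩
    rw [this]
    apply hΩo.sdiff
    have c1 : IsClosed {x : Plane | x 1 = y₁ 1} := isClosed_eq (by fun_prop) (by fun_prop)
    have c2 : IsClosed {x : Plane | (x 0 - y₁ 0) * (x 0 - y₂ 0) ≤ 0} :=
      isClosed_le (by fun_prop) (by fun_prop)
    exact c1.inter c2
  have hS1 : ∀ s ∈ S, s 1 = y₁ 1 := fun s hs => ((hmem s).1 hs).1
  obtain ⟨P, hPo, hPc, hPW, hPmax, hPS⟩ :=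
    side Ω S hΩo hWo (y₁ 1) hS1 hSc hseg hSn 1 one_ne_zero
  obtain ⟨M, hMo, hMc, hMW, hMmax, hMS⟩ :=
    side Ω S hΩo hWo (y₁ 1) hS1 hSc hseg hSn (-1) (by norm_num)
  refine ⟨P, M, hPo, hMo, hPc, hMc, ?_, ?_⟩
  · -- a continuous square root
    by_contra hdis
    rw [Set.not_disjoint_iff_nonempty_inter] at hdis
    have hMP : M ⊆ P := hPmax M hMc.isPreconnected hMW (by rwa [inter_comm])
    let f : Plane → ℂ := fun x =>
      (((x 0 - y₁ 0) * (x 0 - y₂ 0) + (x 1 - y₁ 1) ^ 2 : ℝ) : ℂ)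
        + (((x 1 - y₁ 1) * (y₁ 0 - y₂ 0) : ℝ) : ℂ) * Complex.I
    have hfre : ∀ x, (f x).re = (x 0 - y₁ 0) * (x 0 - y₂ 0) + (x 1 - y₁ 1) ^ 2 := by
      intro x
      simp only [f, Complex.add_re, Complex.ofReal_re, Complex.re_ofReal_mul, Complex.I_re]
      ring
    have hfim : ∀ x, (f x).im = (x 1 - y₁ 1) * (y₁ 0 - y₂ 0) := by
      intro x
      simp only [f, Complex.add_im, Complex.ofReal_im, Complex.im_ofReal_mul, Complex.I_im]
      ring
    have hfc : Continuous f := by fun_prop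
    have hf0 : (0 : ℂ) ∉ f '' Ω := by
      rintro ⟨x, hx, hfx⟩
      have h1 := hfre x
      have h2 := hfim x
      rw [hfx] at h1 h2
      have h3 : x 1 - y₁ 1 = 0 := by
        rcases mul_eq_zero.1 h2.symm with h | h
        · exact h
        · exact absurd h h0
      rw [h3] at h1
      have h4 : (x 0 - y₁ 0) * (x 0 - y₂ 0) = 0 := by simpa using h1.symm
      have h5 := ((hmem x).1 (hmem' x hx (by linarith) h4.le)).2
      linarith
    have hsc : IsSimplyConnected Ω := hΩsc
    obtain ⟨R, hRc, hR⟩ := Complex.exists_continuousOn_pow_eq hsc hΩo hfc.continuousOn hf0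
      (n := 2) two_ne_zero
    have hRre : ∀ x, (R x).re ^ 2 - (R x).im ^ 2
        = (x 0 - y₁ 0) * (x 0 - y₂ 0) + (x 1 - y₁ 1) ^ 2 := by
      intro x
      rw [← hfre, ← hR x, pow_two (R x), Complex.mul_re]; ring
    have hRim : ∀ x, 2 * ((R x).re * (R x).im) = (x 1 - y₁ 1) * (y₁ 0 - y₂ 0) := by
      intro x
      rw [← hfim, ← hR x, pow_two (R x), Complex.mul_im]; ring
    have hne0 : ∀ x ∈ P, (R x).re ≠ 0 := by
      intro x hx h
      have h1 := hRre x
      have h2 := hRim x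
      rw [h] at h1 h2
      have h3 : x 1 - y₁ 1 = 0 := by
        rcases mul_eq_zero.1 (h2.symm.trans (by ring : (2 * (0 * (R x).im) : ℝ) = 0)) with h | h
        · exact h
        · exact absurd h h0
      rw [h3] at h1
      exact (hPW hx).2 (hmem' x (hPW hx).1 (by linarith) (by nlinarith [sq_nonneg (R x).im]))
    have hRPc : ContinuousOn (fun x => (R x).re) P :=
      Complex.continuous_re.comp_continuousOn (hRc.mono fun x hx => (hPW hx).1)
    have hsign : ∀ p ∈ P, ∀ q ∈ P, 0 < (R p).re * (R q).re := by
      intro p hp q hq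
      rcases hPc.isPreconnected.mapsTo_Ioi_or_Iio hRPc hne0 with h | h
      · exact mul_pos (h hp) (h hq)
      · exact mul_pos_of_neg_of_neg (h hp) (h hq)
    obtain ⟨s, hs⟩ := hSn
    have hsim : (R s).im ≠ 0 := by
      intro h
      have h1 := hRre s
      obtain ⟨h2, h3⟩ := (hmem s).1 hs
      rw [h, h2] at h1
      nlinarith [sq_nonneg (R s).re]
    have hcs : ContinuousAt (fun x => (R x).im * (R s).im) s :=
      (Complex.continuous_im.continuousAt.comp
        (hRc.continuousAt (hΩo.mem_nhds (hseg hs)))).mul continuousAt_const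
    have hev : ∀ᶠ x in 𝓝 s, 0 < (R x).im * (R s).im :=
      hcs.eventually (lt_mem_nhds (mul_self_pos.2 hsim))
    obtain ⟨p, ⟨hp1, hp2⟩, hp⟩ := exists_side_pt (y₁ 1) 1 one_ne_zero s (hS1 s hs) _
      (hev.and (hPS s hs))
    obtain ⟨m, ⟨hm1, hm2⟩, hm⟩ := exists_side_pt (y₁ 1) (-1) (by norm_num) s (hS1 s hs) _
      (hev.and (hMS s hs))
    have h1 := hsign p (hp2 hp) m (hMP (hm2 hm))
    have h2 : 0 < (R p).im * (R m).im := by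
      have := mul_pos hp1 hm1
      have h : (R p).im * (R s).im * ((R m).im * (R s).im)
        = (R p).im * (R m).im * (R s).im ^ 2 := by ring
      rw [h] at this
      exact pos_of_mul_pos_left this (sq_nonneg _)
    have h3 := mul_pos h1 h2
    have h4 : (R p).re * (R m).re * ((R p).im * (R m).im) * 4
        = ((p 1 - y₁ 1) * (m 1 - y₁ 1)) * (y₁ 0 - y₂ 0) ^ 2 := by
      linear_combination (2 * ((R m).re * (R m).im)) * hRim p
        + ((p 1 - y₁ 1) * (y₁ 0 - y₂ 0)) * hRim m
    have h5 : (p 1 - y₁ 1) * (m 1 - y₁ 1) < 0 := by nlinarith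
    have h6 : 0 < (y₁ 0 - y₂ 0) ^ 2 := by positivity
    nlinarith
  · apply Subset.antisymm _ (union_subset hPW hMW)
    have hΩc : IsPreconnected Ω := isPreconnected_iff_preconnectedSpace.2 inferInstance
    have hsub : Ω ⊆ P ∪ M ∪ S := by
      apply hΩc.subset_of_closure_inter_subset
      · rw [isOpen_iff_mem_nhds]
        rintro x ((hx | hx) | hx)
        · filter_upwards [hPo.mem_nhds hx] with y hy using Or.inl (Or.inl hy)
        · filter_upwards [hMo.mem_nhds hx] with y hy using Or.inl (Or.inr hy)
        · have ho : IsOpen {z : Plane | (z 0 - y₁ 0) * (z 0 - y₂ 0) < 0} :=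
            isOpen_lt (by fun_prop) (by fun_prop)
          filter_upwards [hPS x hx, hMS x hx, ho.mem_nhds ((hmem x).1 hx).2] with z h1 h2 h3
          rcases lt_trichotomy (z 1) (y₁ 1) with h | h | h
          · exact Or.inl (Or.inr (h2 (by linarith)))
          · exact Or.inr ((hmem z).2 ⟨h, h3⟩)
          · exact Or.inl (Or.inl (h1 (by linarith)))
      · obtain ⟨s, hs⟩ := hSn
        exact ⟨s, hseg hs, Or.inr hs⟩
      · rintro z ⟨hzc, hzΩ⟩
        by_cases hzS : z ∈ S
        · exact Or.inr hzS
        have hzW : z ∈ Ω \ S := ⟨hzΩ, hzS⟩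
        have hzC := mem_connectedComponentIn hzW
        obtain ⟨q, hqC, hq⟩ := mem_closure_iff.1 hzc _ (hWo.connectedComponentIn (x := z)) hzC
        have hCW := connectedComponentIn_subset (Ω \ S) z
        rcases hq with (hq | hq) | hq
        · exact Or.inl (Or.inl (hPmax _ isPreconnected_connectedComponentIn hCW ⟨q, hqC, hq⟩ hzC))
        · exact Or.inl (Or.inr (hMmax _ isPreconnected_connectedComponentIn hCW ⟨q, hqC, hq⟩ hzC))
        · exact absurd hq (hCW hqC).2
    rintro x ⟨hx, hxS⟩
    exact (hsub hx).resolve_right hxS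
end
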